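/- In a locally λ-presentable category 𝒜, a morphism p : X → Y is a λ-local retraction if and only if p can be written as a λ-filtered colimit, in the arrow category 𝒜^→, of retractions in 𝒜. -/

import Mathlib

open CategoryTheory CategoryTheory.Limits Opposite

universe w v u

namespace Paper

variable {C : Type u} [Category.{v} C]

/-- A category is `κ`-filtered if every diagram with fewer than `κ` many morphisms
admits a cocone. -/
def IsCardinalFiltered (κ : Cardinal.{v}) (J : Type v) [Category.{v} J] : Prop :=
  ∀ (K : Type v) [Category.{v} K],
    Cardinal.mk (Σ (a : K) (b : K), a ⟶ b) < κ → ∀ F : K ⥤ J, Nonempty (Limits.Cocone F)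

/-- An object `X` is `κ`-presentable if its hom-functor `Hom(X, -)` preserves
`κ`-filtered colimits. -/
def IsPresentableObj (κ : Cardinal.{v}) (X : C) : Prop :=
  ∀ (J : Type v) [Category.{v} J], IsCardinalFiltered κ J →
    Nonempty (PreservesColimitsOfShape J (coyoneda.obj (op X)))

/-- A category is locally `κ`-presentable if it is cocomplete and has a small family of
`κ`-presentable objects such that every object is a `κ`-filtered colimit of objects
from this family. -/
def LocallyPresentable (κ : Cardinal.{v}) (C : Type u) [Category.{v} C] : Prop :=
  HasColimits C ∧
    ∃ S : Set C, Small.{v} S ∧ (∀ X ∈ S, IsPresentableObj κ X) ∧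
      ∀ X : C, ∃ (J : Type v) (_ : Category.{v} J) (F : J ⥤ C) (c : Limits.Cocone F),
        IsCardinalFiltered κ J ∧ Nonempty (Limits.IsColimit c) ∧ c.pt = X ∧
          ∀ j, F.obj j ∈ S

/-- `e ⊥ m`: every commutative square from `e` to `m` has a unique diagonal filler. -/
def UniqueLift {A B X Y : C} (e : A ⟶ B) (m : X ⟶ Y) : Prop :=
  ∀ (u : A ⟶ X) (v : B ⟶ Y), u ≫ m = e ≫ v →
    ∃! d : B ⟶ X, e ≫ d = u ∧ d ≫ m = v

/-- `p : X ⟶ Y` is a `κ`-local retraction if every morphism from a `κ`-presentable object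
into `Y` lifts along `p`. -/
def IsLocalRetraction (κ : Cardinal.{v}) {X Y : C} (p : X ⟶ Y) : Prop :=
  ∀ (Γ : C), IsPresentableObj κ Γ → ∀ f : Γ ⟶ Y, ∃ g : Γ ⟶ X, g ≫ p = f

section Comparison

variable {κ : Cardinal.{v}} [Fact κ.IsRegular]

theorem isCardinalFiltered_iff (J : Type v) [Category.{v} J] :
    IsCardinalFiltered κ J ↔ CategoryTheory.IsCardinalFiltered J κ := by
  have key (K : Type v) [Category.{v} K] :
      HasCardinalLT (Arrow K) κ ↔ Cardinal.mk (Σ (a : K) (b : K), a ⟶ b) < κ := by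
    rw [hasCardinalLT_iff_of_equiv (Arrow.equivSigma K), hasCardinalLT_iff_cardinal_mk_lt]
  exact ⟨fun h ↦ ⟨fun F hA ↦ h _ ((key _).1 hA) F⟩,
    fun _ K _ hK F ↦ ⟨CategoryTheory.IsCardinalFiltered.cocone F ((key K).2 hK)⟩⟩

theorem isPresentableObj_iff (X : C) :
    IsPresentableObj κ X ↔ IsCardinalPresentable X κ :=
  ⟨fun h ↦ ⟨fun J _ hJ ↦ (h J ((isCardinalFiltered_iff J).2 hJ)).some⟩,
    fun _ J _ hJ ↦
      have := (isCardinalFiltered_iff J).1 hJ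
      ⟨preservesColimitsOfShape_of_isCardinalPresentable X κ J⟩⟩

theorem LocallyPresentable.isCardinalLocallyPresentable (hC : LocallyPresentable κ C) :
    IsCardinalLocallyPresentable C κ := by
  obtain ⟨_, S, hS, hpres, hgen⟩ := hC
  let P : ObjectProperty C := fun X ↦ X ∈ S
  have : ObjectProperty.Small.{v} P := hS
  have hP : P.IsCardinalFilteredGenerator κ :=
    { le_isCardinalPresentable := fun X hX ↦ (isPresentableObj_iff X).1 (hpres X hX)
      exists_colimitsOfShape := fun X ↦ by
        obtain ⟨J, _, F, c, hJ, ⟨hc⟩, rfl, hF⟩ := hgen X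
        exact ⟨J, inferInstance, (isCardinalFiltered_iff J).1 hJ,
          ⟨{ diag := F, ι := c.ι, isColimit := hc, prop_diag_obj := hF }⟩⟩ }
  have := hP.hasCardinalFilteredGenerator
  constructor

end Comparison

section LocallyPresentable

variable (κ : Cardinal.{v}) [Fact κ.IsRegular]

/-- A locally presentable category is a reflective subcategory of the category of presheaves
on its presentable objects, hence is complete. -/
theorem hasLimits_of_isCardinalLocallyPresentable (C : Type u) [Category.{v} C]
    [IsCardinalLocallyPresentable C κ] : HasLimits C := by
  let A : SmallModel.{v} (isCardinalPresentable C κ).FullSubcategory ⥤ C :=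
    (equivSmallModel.{v} _).inverse ⋙ (isCardinalPresentable C κ).ι
  let adj := Presheaf.uliftYonedaAdjunction.{v} _
    (uliftYoneda.{v}.leftKanExtensionUnit A)
  let _ : Reflective (Presheaf.restrictedULiftYoneda.{v} A) := { L := _, adj := adj }
  exact hasLimits_of_reflective (Presheaf.restrictedULiftYoneda.{v} A)

variable {κ}

/-- A cocone over a `κ`-filtered diagram is a colimit as soon as it satisfies the factorization
property of `κ`-presentable objects with respect to a strong generator. -/
theorem nonempty_isColimit_of_isStrongGenerator {P : ObjectProperty C}
    (hP : P.IsStrongGenerator) (hP' : P ≤ isCardinalPresentable C κ)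
    {J : Type v} [SmallCategory J] [CategoryTheory.IsCardinalFiltered J κ] {F : J ⥤ C}
    [HasColimit F] (c : Cocone F)
    (hsurj : ∀ (G : C), P G → ∀ x : G ⟶ c.pt, ∃ (j : J) (y : G ⟶ F.obj j), y ≫ c.ι.app j = x)
    (hinj : ∀ (G : C), P G → ∀ (j : J) (a b : G ⟶ F.obj j), a ≫ c.ι.app j = b ≫ c.ι.app j →
      ∃ (k : J) (u : j ⟶ k), a ≫ F.map u = b ≫ F.map u) :
    Nonempty (IsColimit c) := by
  have := isFiltered_of_isCardinalFiltered J κ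
  have : Mono (colimit.desc F c) := ⟨fun {Z} a b hab ↦ by
    refine hP.isSeparating _ _ fun G hG h ↦ ?_
    have : IsCardinalPresentable G κ := hP' G hG
    obtain ⟨i, a', ha⟩ := IsCardinalPresentable.exists_hom_of_isColimit κ
      (colimit.isColimit F) (h ≫ a)
    obtain ⟨j, b', hb⟩ := IsCardinalPresentable.exists_hom_of_isColimit κ
      (colimit.isColimit F) (h ≫ b)
    obtain ⟨k, u, hu⟩ := hinj G hG (IsFiltered.max i j)
      (a' ≫ F.map (IsFiltered.leftToMax i j)) (b' ≫ F.map (IsFiltered.rightToMax i j)) (by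
        have := h ≫= hab
        rw [← Category.assoc, ← Category.assoc, ← ha, ← hb] at this
        simpa using this)
    rw [← ha, ← hb]
    have := hu =≫ colimit.ι F k
    simpa using this⟩
  have : IsIso (colimit.desc F c) := hP.isIso_of_mono _ fun G hG x ↦ by
    obtain ⟨j, y, rfl⟩ := hsurj G hG x
    exact ⟨y ≫ colimit.ι F j, by simp⟩
  exact (colimit.isColimit F).nonempty_isColimit_iff_isIso_desc.2 this

end LocallyPresentable

section Arrow

variable {J : Type w} [Category.{v} J]

/-- Colimits in the arrow category can be checked on domains and codomains. -/
def isColimitOfLeftRight {D : J ⥤ Arrow C} {c : Cocone D}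
    (hl : IsColimit (Arrow.leftFunc.mapCocone c)) (hr : IsColimit (Arrow.rightFunc.mapCocone c)) :
    IsColimit c where
  desc s := Arrow.homMk (hl.desc (Arrow.leftFunc.mapCocone s))
    (hr.desc (Arrow.rightFunc.mapCocone s)) (hl.hom_ext fun j ↦ by
      let l : c.pt.left ⟶ s.pt.left := hl.desc (Arrow.leftFunc.mapCocone s)
      let r : c.pt.right ⟶ s.pt.right := hr.desc (Arrow.rightFunc.mapCocone s)
      have h₁ : (c.ι.app j).left ≫ l = (s.ι.app j).left :=
        hl.fac (Arrow.leftFunc.mapCocone s) j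
      have h₂ : (c.ι.app j).right ≫ r = (s.ι.app j).right :=
        hr.fac (Arrow.rightFunc.mapCocone s) j
      change (c.ι.app j).left ≫ l ≫ s.pt.hom = (c.ι.app j).left ≫ c.pt.hom ≫ r
      have hw₁ : (c.ι.app j).left ≫ c.pt.hom = (D.obj j).hom ≫ (c.ι.app j).right :=
        Arrow.w (c.ι.app j)
      have hw₂ : (s.ι.app j).left ≫ s.pt.hom = (D.obj j).hom ≫ (s.ι.app j).right :=
        Arrow.w (s.ι.app j)
      rw [reassoc_of% h₁, reassoc_of% hw₁, h₂, hw₂])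
  fac s j := by
    ext
    · exact hl.fac (Arrow.leftFunc.mapCocone s) j
    · exact hr.fac (Arrow.rightFunc.mapCocone s) j
  uniq s m hm := by
    ext
    · exact hl.uniq (Arrow.leftFunc.mapCocone s) m.left
        fun j ↦ congr_arg CommaMorphism.left (hm j)
    · exact hr.uniq (Arrow.rightFunc.mapCocone s) m.right
        fun j ↦ congr_arg CommaMorphism.right (hm j)

theorem isLocalRetraction_of_isColimit {κ : Cardinal.{v}} {J : Type v} [Category.{v} J]
    [HasColimitsOfShape J C] (hJ : IsCardinalFiltered κ J)
    {D : J ⥤ Arrow C} (hD : ∀ j, IsSplitEpi (D.obj j).hom)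
    {c : Cocone D} (hc : IsColimit c) : IsLocalRetraction κ c.pt.hom := by
  intro Γ hΓ f
  have := (hΓ J hJ).some
  obtain ⟨j, g, hg⟩ := exists_hom_of_preservesColimit_coyoneda
    (isColimitOfPreserves Arrow.rightFunc hc) f
  obtain ⟨⟨s, hs⟩⟩ := hD j
  refine ⟨g ≫ s ≫ (c.ι.app j).left, ?_⟩
  have hw : (c.ι.app j).left ≫ c.pt.hom = (D.obj j).hom ≫ (c.ι.app j).right :=
    Arrow.w (c.ι.app j)
  have hs' : (s ≫ (c.ι.app j).left) ≫ c.pt.hom = (c.ι.app j).right := by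
    rw [Category.assoc, hw, reassoc_of% hs]
  exact (Category.assoc _ _ _).trans ((congr_arg (g ≫ ·) hs').trans hg)

variable [HasPullbacks C] {X : C} {F : J ⥤ C} (c : Cocone F) (p : X ⟶ c.pt)

/-- The transition map between base changes of `p : X ⟶ c.pt` along the legs of a cocone `c`. -/
noncomputable def pullbackTransition {i j : J} (u : i ⟶ j) :
    pullback p (c.ι.app i) ⟶ pullback p (c.ι.app j) :=
  pullback.lift (pullback.fst _ _) (pullback.snd _ _ ≫ F.map u) (by simp [pullback.condition])

@[simp]
theorem pullbackTransition_fst {i j : J} (u : i ⟶ j) :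
    pullbackTransition c p u ≫ pullback.fst _ _ = pullback.fst _ _ :=
  pullback.lift_fst _ _ _

@[simp]
theorem pullbackTransition_snd {i j : J} (u : i ⟶ j) :
    pullbackTransition c p u ≫ pullback.snd _ _ = pullback.snd _ _ ≫ F.map u :=
  pullback.lift_snd _ _ _

/-- The base changes of `p : X ⟶ c.pt` along the legs of a cocone `c`. -/
noncomputable def pullbackDiagram : J ⥤ Arrow C where
  obj j := Arrow.mk (pullback.snd p (c.ι.app j))
  map u := Arrow.homMk (pullbackTransition c p u) (F.map u) (pullbackTransition_snd c p u)
  map_id j := Arrow.hom_ext _ _ (pullback.hom_ext (by simp) (by simp)) (F.map_id j)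
  map_comp u v := Arrow.hom_ext _ _ (pullback.hom_ext (by simp)
    (by simp [reassoc_of% pullbackTransition_snd c p u])) (F.map_comp u v)

/-- The cocone with point `p : X ⟶ c.pt` over the base changes of `p` along the legs of `c`. -/
noncomputable def pullbackCocone : Cocone (pullbackDiagram c p) where
  pt := Arrow.mk p
  ι :=
    { app := fun j ↦ Arrow.homMk (pullback.fst p (c.ι.app j)) (c.ι.app j) pullback.condition
      naturality := fun _ _ u ↦ Arrow.hom_ext _ _
        ((pullbackTransition_fst c p u).trans (Category.comp_id _).symm) (c.ι.naturality u) }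

/-- In a locally `κ`-presentable category, `κ`-filtered colimits are universal. -/
theorem nonempty_isColimit_pullbackCocone {κ : Cardinal.{v}} [Fact κ.IsRegular]
    [IsCardinalLocallyPresentable C κ] {J : Type v} [SmallCategory J]
    [CategoryTheory.IsCardinalFiltered J κ] {F : J ⥤ C} {c : Cocone F} (hc : IsColimit c)
    (p : X ⟶ c.pt) : Nonempty (IsColimit (pullbackCocone c p)) := by
  obtain ⟨P, _, hP⟩ := HasCardinalFilteredGenerator.exists_generator C κ
  have hP' := hP.le_isCardinalPresentable
  suffices Nonempty (IsColimit (Arrow.leftFunc.mapCocone (pullbackCocone c p))) from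
    ⟨isColimitOfLeftRight this.some hc⟩
  refine nonempty_isColimit_of_isStrongGenerator hP.isStrongGenerator hP' _ ?_ ?_
  · intro G hG (x : G ⟶ X)
    have : IsCardinalPresentable G κ := hP' G hG
    obtain ⟨j, y, hy⟩ := IsCardinalPresentable.exists_hom_of_isColimit κ hc (x ≫ p)
    exact ⟨j, pullback.lift x y hy.symm, pullback.lift_fst _ _ _⟩
  · intro G hG j (a : G ⟶ pullback p (c.ι.app j)) (b : G ⟶ pullback p (c.ι.app j))
      (hab : a ≫ pullback.fst p (c.ι.app j) = b ≫ pullback.fst p (c.ι.app j))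
    have : IsCardinalPresentable G κ := hP' G hG
    obtain ⟨k, u, hu⟩ := IsCardinalPresentable.exists_eq_of_isColimit' κ hc
      (a ≫ pullback.snd p (c.ι.app j)) (b ≫ pullback.snd p (c.ι.app j)) (by
        simp [← pullback.condition, reassoc_of% hab])
    have huv : a ≫ pullbackTransition c p u = b ≫ pullbackTransition c p u :=
      pullback.hom_ext (by simpa using hab) (by simpa using hu)
    exact ⟨k, u, huv⟩

end Arrow

/-- In a locally `κ`-presentable category, a morphism is a `κ`-local retraction iff it is
a `κ`-filtered colimit, in the arrow category, of retractions. -/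
theorem statement15 {C : Type u} [Category.{v} C] (κ : Cardinal.{v}) (hreg : κ.IsRegular)
    (hC : LocallyPresentable κ C) {X Y : C} (p : X ⟶ Y) :
    IsLocalRetraction κ p ↔
      ∃ (J : Type v) (_ : Category.{v} J) (D : J ⥤ Arrow C) (c : Limits.Cocone D),
        IsCardinalFiltered κ J ∧ (∀ j : J, IsSplitEpi (D.obj j).hom) ∧
          Nonempty (Limits.IsColimit c) ∧ c.pt = Arrow.mk p := by
  have : Fact κ.IsRegular := ⟨hreg⟩
  refine ⟨fun hp ↦ ?_, ?_⟩
  · have := hC.isCardinalLocallyPresentable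
    have := hasLimits_of_isCardinalLocallyPresentable κ C
    obtain ⟨-, S, -, hS, hgen⟩ := hC
    obtain ⟨J, _, F, c, hJ, ⟨hc⟩, rfl, hF⟩ := hgen Y
    have := (isCardinalFiltered_iff (κ := κ) J).1 hJ
    refine ⟨J, inferInstance, pullbackDiagram c p, pullbackCocone c p, hJ, fun j ↦ ?_,
      nonempty_isColimit_pullbackCocone (κ := κ) hc p, rfl⟩
    obtain ⟨g, hg⟩ := hp _ (hS _ (hF j)) (c.ι.app j)
    exact ⟨⟨⟨pullback.lift g (𝟙 _) (hg.trans (Category.id_comp _).symm), pullback.lift_snd _ _ _⟩⟩⟩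
  · rintro ⟨J, _, D, c, hJ, hD, ⟨hc⟩, hcp⟩
    have := hC.1
    have := isLocalRetraction_of_isColimit hJ hD hc
    rwa [hcp] at this

end Paper
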